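/- On any almost coKähler manifold (M, φ, ξ, η, g), the 1-form η and the fundamental 2-form Φ are harmonic. -/

import Mathlib

noncomputable section

open Classical

/-- An abstract model of a smooth manifold together with the operations of
Cartan calculus (smooth functions, vector fields, differential forms, exterior
differential, interior and wedge products, Lie bracket), with pointwise
evaluation into the tangent spaces. -/
structure SmoothCtx : Type 1 where
  /-- the set of points of the manifold -/
  M : Type
  [topM : TopologicalSpace M]
  [neM : Nonempty M]
  /-- the dimension of the manifold -/
  dim : ℕ
  /-- tangent spaces -/
  T : M → Type
  [instTG : (x : M) → AddCommGroup (T x)]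
  [instTM : (x : M) → Module ℝ (T x)]
  tdim : ∀ x : M, Module.finrank ℝ (T x) = dim
  /-- smooth real valued functions -/
  Fn : Type
  [instFnRing : CommRing Fn]
  [instFnAlg : Algebra ℝ Fn]
  /-- evaluation of smooth functions at points -/
  evF : Fn →+* (M → ℝ)
  evF_cont : ∀ f : Fn, Continuous (evF f)
  /-- smooth vector fields -/
  Vec : Type
  [instVecGrp : AddCommGroup Vec]
  [instVecMod : Module Fn Vec]
  /-- evaluation of vector fields at points -/
  evV : Vec → (x : M) → T x
  evV_add : ∀ X Y x, evV (X + Y) x = evV X x + evV Y x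
  evV_smul : ∀ f X x, evV (f • X) x = evF f x • evV X x
  evV_surj : ∀ x : M, Function.Surjective (fun X => evV X x)
  /-- the derivative of a function along a vector field -/
  act : Vec → Fn → Fn
  act_add : ∀ X f g, act X (f + g) = act X f + act X g
  act_mul : ∀ X f g, act X (f * g) = f * act X g + g * act X f
  act_addX : ∀ X Y f, act (X + Y) f = act X f + act Y f
  act_smulX : ∀ f X h, act (f • X) h = f * act X h
  act_local : ∀ X Y f x, evV X x = evV Y x → evF (act X f) x = evF (act Y f) x
  /-- the Lie bracket of vector fields -/
  bracket : Vec → Vec → Vec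
  bracket_skew : ∀ X Y, bracket X Y = - bracket Y X
  bracket_addl : ∀ X Y Z, bracket (X + Y) Z = bracket X Z + bracket Y Z
  bracket_act : ∀ X Y f, act (bracket X Y) f = act X (act Y f) - act Y (act X f)
  bracket_leibniz : ∀ X f Y, bracket X (f • Y) = f • bracket X Y + (act X f) • Y
  /-- differential forms of each degree -/
  Form : ℕ → Type
  [instFormGrp : (k : ℕ) → AddCommGroup (Form k)]
  [instFormModF : (k : ℕ) → Module Fn (Form k)]
  [instFormModR : (k : ℕ) → Module ℝ (Form k)]
  smul_alg : ∀ (r : ℝ) {k : ℕ} (α : Form k), (algebraMap ℝ Fn r) • α = r • α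
  /-- evaluation of a `k`-form on `k` vector fields -/
  evK : {k : ℕ} → Form k → (Fin k → Vec) → Fn
  evK_add : ∀ {k} (α β : Form k) v, evK (α + β) v = evK α v + evK β v
  evK_smulF : ∀ {k} (f : Fn) (α : Form k) v, evK (f • α) v = f * evK α v
  evK_update_add : ∀ {k} (α : Form k) (v : Fin k → Vec) (i : Fin k) X Y,
    evK α (Function.update v i (X + Y)) =
      evK α (Function.update v i X) + evK α (Function.update v i Y)
  evK_update_smul : ∀ {k} (α : Form k) (v : Fin k → Vec) (i : Fin k) f X,
    evK α (Function.update v i (f • X)) = f * evK α (Function.update v i X)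
  evK_alt : ∀ {k} (α : Form k) (v : Fin k → Vec) (i j : Fin k),
    i ≠ j → v i = v j → evK α v = 0
  evK_local : ∀ {k} (α : Form k) (v w : Fin k → Vec) (x : M),
    (∀ i, evV (v i) x = evV (w i) x) → evF (evK α v) x = evF (evK α w) x
  evK_inj : ∀ {k} (α β : Form k), (∀ v, evK α v = evK β v) → α = β
  /-- the exterior differential -/
  d : {k : ℕ} → Form k → Form (k + 1)
  d_add : ∀ {k} (α β : Form k), d (α + β) = d α + d β
  d_smulR : ∀ (r : ℝ) {k} (α : Form k), d (r • α) = r • d α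
  dd : ∀ {k} (α : Form k), d (d α) = 0
  d1_eval : ∀ (α : Form 1) (X Y : Vec),
    evK (d α) ![X, Y] =
      act X (evK α ![Y]) - act Y (evK α ![X]) - evK α ![bracket X Y]
  d2_eval : ∀ (α : Form 2) (X Y Z : Vec),
    evK (d α) ![X, Y, Z] =
      act X (evK α ![Y, Z]) - act Y (evK α ![X, Z]) + act Z (evK α ![X, Y])
        - evK α ![bracket X Y, Z] + evK α ![bracket X Z, Y] - evK α ![bracket Y Z, X]
  /-- the differential of a function -/
  dF : Fn → Form 1
  dF_eval : ∀ f X, evK (dF f) ![X] = act X f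
  dF_closed : ∀ f, d (dF f) = 0
  /-- the interior product of a vector field with a form -/
  iota : {k : ℕ} → Vec → Form (k + 1) → Form k
  iota_eval : ∀ {k} (X : Vec) (α : Form (k + 1)) (v : Fin k → Vec),
    evK (iota X α) v = evK α (Fin.cons X v)
  iota_add : ∀ {k} (X : Vec) (α β : Form (k + 1)), iota X (α + β) = iota X α + iota X β
  iota_smulF : ∀ {k} (f : Fn) (X : Vec) (α : Form (k + 1)), iota X (f • α) = f • iota X α
  /-- the wedge product -/
  wedge : {k l : ℕ} → Form k → Form l → Form (k + l)
  wedge_eval : ∀ {k l} (α : Form k) (β : Form l) (v : Fin (k + l) → Vec),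
    evK (wedge α β) v = algebraMap ℝ Fn (((k.factorial : ℝ) * l.factorial)⁻¹) *
      ∑ σ : Equiv.Perm (Fin (k + l)),
        ((Equiv.Perm.sign σ : ℤ) : Fn) *
          (evK α (fun i => v (σ (Fin.castAdd l i))) * evK β (fun j => v (σ (Fin.natAdd k j))))

attribute [instance] SmoothCtx.topM SmoothCtx.neM SmoothCtx.instTG SmoothCtx.instTM
  SmoothCtx.instFnRing SmoothCtx.instFnAlg SmoothCtx.instVecGrp SmoothCtx.instVecMod
  SmoothCtx.instFormGrp SmoothCtx.instFormModF SmoothCtx.instFormModR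

namespace SmoothCtx

variable (C : SmoothCtx)

/-- a 1-form applied to a vector field -/
def ap1 (α : C.Form 1) (X : C.Vec) : C.Fn := C.evK α ![X]

/-- a 2-form applied to two vector fields -/
def ap2 (α : C.Form 2) (X Y : C.Vec) : C.Fn := C.evK α ![X, Y]

/-- the pointwise value of a 1-form on a tangent vector -/
def evalAt1 (α : C.Form 1) (x : C.M) (v : C.T x) : ℝ :=
  C.evF (C.ap1 α (C.evV_surj x v).choose) x

/-- the pointwise value of a 2-form on a pair of tangent vectors -/
def evalAt2 (α : C.Form 2) (x : C.M) (v w : C.T x) : ℝ :=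
  C.evF (C.ap2 α (C.evV_surj x v).choose (C.evV_surj x w).choose) x

/-- the wedge power `η ∧ ω^n` -/
def etaOmegaPow (η : C.Form 1) (ω : C.Form 2) : (n : ℕ) → C.Form (2 * n + 1)
  | 0 => η
  | n + 1 => C.wedge (k := 2 * n + 1) (l := 2) (etaOmegaPow η ω n) ω

/-- a top degree form which vanishes nowhere -/
def IsVolume {m : ℕ} (τ : C.Form m) : Prop :=
  m = C.dim ∧ ∀ x : C.M, ∃ v : Fin m → C.Vec, C.evF (C.evK τ v) x ≠ 0

/-- an almost cosymplectic structure: a 1-form `η` and a 2-form `ω` such that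
`η ∧ ωⁿ` is a volume form -/
def IsAlmostCosymplectic (η : C.Form 1) (ω : C.Form 2) : Prop :=
  ∃ n : ℕ, C.dim = 2 * n + 1 ∧ C.IsVolume (C.etaOmegaPow η ω n)

/-- a cosymplectic structure: `η` and `ω` are moreover closed -/
def IsCosymplectic (η : C.Form 1) (ω : C.Form 2) : Prop :=
  C.d η = 0 ∧ C.d ω = 0 ∧ C.IsAlmostCosymplectic η ω

/-- the Reeb vector field: `i_ξ ω = 0` and `η(ξ) = 1` -/
def IsReeb (η : C.Form 1) (ω : C.Form 2) (ξ : C.Vec) : Prop :=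
  C.iota ξ ω = 0 ∧ C.ap1 η ξ = 1

/-- the map `♭_{(η,ω)}(X) = i_X ω + η(X) η` -/
def flat (η : C.Form 1) (ω : C.Form 2) (X : C.Vec) : C.Form 1 :=
  C.iota X ω + (C.ap1 η X) • η

/-- the inverse of `♭_{(η,ω)}` -/
def sharp (η : C.Form 1) (ω : C.Form 2) : C.Form 1 → C.Vec :=
  letI : Nonempty C.Vec := ⟨0⟩
  Function.invFun (C.flat η ω)

/-- the gradient vector field `grad f = ♭⁻¹(df)` of a cosymplectic structure -/
def grad (η : C.Form 1) (ω : C.Form 2) (f : C.Fn) : C.Vec :=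
  C.sharp η ω (C.dF f)

/-- the Hamiltonian vector field `X_f = ♭⁻¹(df - ξ(f)η)` of a cosymplectic
structure with Reeb vector field `ξ` -/
def ham (η : C.Form 1) (ω : C.Form 2) (ξ : C.Vec) (f : C.Fn) : C.Vec :=
  C.sharp η ω (C.dF f - (C.act ξ f) • η)

/-- the Poisson bracket `{f,g} = ω(grad f, grad g)` induced by a cosymplectic
structure -/
def poisson (η : C.Form 1) (ω : C.Form 2) (f g : C.Fn) : C.Fn :=
  C.ap2 ω (C.grad η ω f) (C.grad η ω g)

/-- a symplectic structure: a closed nondegenerate 2-form -/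
def IsSymplectic (ω : C.Form 2) : Prop :=
  C.d ω = 0 ∧ ∀ (x : C.M) (v : C.T x), v ≠ 0 → ∃ w : C.T x, C.evalAt2 ω x v w ≠ 0

/-- the map `X ↦ i_X ω` of a symplectic structure -/
def symplFlat (ω : C.Form 2) (X : C.Vec) : C.Form 1 := C.iota X ω

/-- the Hamiltonian vector field of a function on a symplectic manifold -/
def symplHam (ω : C.Form 2) (f : C.Fn) : C.Vec :=
  letI : Nonempty C.Vec := ⟨0⟩
  Function.invFun (C.symplFlat ω) (C.dF f)

/-- the Poisson bracket of a symplectic structure -/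
def symplPoisson (ω : C.Form 2) (f g : C.Fn) : C.Fn :=
  C.ap2 ω (C.symplHam ω f) (C.symplHam ω g)

end SmoothCtx

/-- a Riemannian metric -/
structure MetricStr (C : SmoothCtx) where
  g : C.Vec → C.Vec → C.Fn
  g_symm : ∀ X Y, g X Y = g Y X
  g_add : ∀ X Y Z, g (X + Y) Z = g X Z + g Y Z
  g_smul : ∀ (f : C.Fn) X Y, g (f • X) Y = f * g X Y
  g_local : ∀ X X' Y x, C.evV X x = C.evV X' x → C.evF (g X Y) x = C.evF (g X' Y) x
  g_pos : ∀ X x, 0 ≤ C.evF (g X X) x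
  g_defin : ∀ X x, C.evF (g X X) x = 0 → C.evV X x = 0

/-- the Levi-Civita connection of a Riemannian metric: the unique torsion free
metric connection -/
structure LeviCivita (C : SmoothCtx) (G : MetricStr C) where
  nabla : C.Vec → C.Vec → C.Vec
  nabla_addl : ∀ X Y Z, nabla (X + Y) Z = nabla X Z + nabla Y Z
  nabla_smull : ∀ (f : C.Fn) X Y, nabla (f • X) Y = f • nabla X Y
  nabla_addr : ∀ X Y Z, nabla X (Y + Z) = nabla X Y + nabla X Z
  nabla_leibniz : ∀ X (f : C.Fn) Y, nabla X (f • Y) = f • nabla X Y + (C.act X f) • Y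
  torsion_free : ∀ X Y, nabla X Y - nabla Y X = C.bracket X Y
  compat : ∀ X Y Z, C.act X (G.g Y Z) = G.g (nabla X Y) Z + G.g Y (nabla X Z)

/-- the Riemann curvature operator `R(X,Y)Z = ∇_X∇_Y Z - ∇_Y∇_X Z - ∇_[X,Y] Z` -/
def LeviCivita.R {C : SmoothCtx} {G : MetricStr C} (D : LeviCivita C G)
    (X Y Z : C.Vec) : C.Vec :=
  D.nabla X (D.nabla Y Z) - D.nabla Y (D.nabla X Z) - D.nabla (C.bracket X Y) Z

/-- a global orthonormal frame -/
structure OrthFrame (C : SmoothCtx) (G : MetricStr C) where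
  E : Fin C.dim → C.Vec
  orth : ∀ i j, G.g (E i) (E j) = if i = j then 1 else 0
  span : ∀ X, ∑ i, (G.g X (E i)) • E i = X

/-- the Ricci tensor, computed with an orthonormal frame -/
def ricci {C : SmoothCtx} {G : MetricStr C} (D : LeviCivita C G) (F : OrthFrame C G)
    (X Y : C.Vec) : C.Fn :=
  ∑ i, G.g (D.R (F.E i) X Y) (F.E i)

/-- the Ricci operator, `g(Ric♯ X, Y) = Ric(X,Y)` -/
def ricciOp {C : SmoothCtx} {G : MetricStr C} (D : LeviCivita C G) (F : OrthFrame C G)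
    (X : C.Vec) : C.Vec :=
  ∑ i, (ricci D F X (F.E i)) • F.E i

/-- an almost contact metric structure `(φ, ξ, η, g)` with fundamental 2-form `Φ` -/
structure AlmostContactMetric (C : SmoothCtx) extends MetricStr C where
  φ : C.Vec → C.Vec
  φ_add : ∀ X Y, φ (X + Y) = φ X + φ Y
  φ_smul : ∀ (f : C.Fn) X, φ (f • X) = f • φ X
  φ_local : ∀ X Y x, C.evV X x = C.evV Y x → C.evV (φ X) x = C.evV (φ Y) x
  ξ : C.Vec
  η : C.Form 1
  acs_sq : ∀ X, φ (φ X) = -X + (C.ap1 η X) • ξ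
  acs_eta : C.ap1 η ξ = 1
  compat_g : ∀ X Y, g (φ X) (φ Y) = g X Y - C.ap1 η X * C.ap1 η Y
  /-- the fundamental 2-form `Φ(X,Y) = g(X, φY)` -/
  Φ : C.Form 2
  Φ_eval : ∀ X Y, C.ap2 Φ X Y = g X (φ Y)

/-- the Nijenhuis torsion `[φ,φ]` of a (1,1)-tensor field -/
def nijTensor (C : SmoothCtx) (φ : C.Vec → C.Vec) (X Y : C.Vec) : C.Vec :=
  φ (φ (C.bracket X Y)) + C.bracket (φ X) (φ Y)
    - φ (C.bracket (φ X) Y) - φ (C.bracket X (φ Y))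

/-- the tensor `N^{(1)} = [φ,φ] + 2dη ⊗ ξ` -/
def N1 (C : SmoothCtx) (φ : C.Vec → C.Vec) (ξ : C.Vec) (η : C.Form 1)
    (X Y : C.Vec) : C.Vec :=
  nijTensor C φ X Y +
    (C.act X (C.ap1 η Y) - C.act Y (C.ap1 η X) - C.ap1 η (C.bracket X Y)) • ξ

/-- almost coKähler: `η` and `Φ` are closed -/
def IsAlmostCoKaehler (C : SmoothCtx) (A : AlmostContactMetric C) : Prop :=
  C.d A.η = 0 ∧ C.d A.Φ = 0

/-- normality of an almost contact structure -/
def IsNormal (C : SmoothCtx) (A : AlmostContactMetric C) : Prop :=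
  ∀ X Y, N1 C A.φ A.ξ A.η X Y = 0

/-- coKähler: almost coKähler and normal -/
def IsCoKaehler (C : SmoothCtx) (A : AlmostContactMetric C) : Prop :=
  IsAlmostCoKaehler C A ∧ IsNormal C A

/-- the operator `h = ½ L_ξ φ` -/
def hOp (C : SmoothCtx) (A : AlmostContactMetric C) (X : C.Vec) : C.Vec :=
  (algebraMap ℝ C.Fn (1 / 2)) • (C.bracket A.ξ (A.φ X) - A.φ (C.bracket A.ξ X))

/-- the covariant derivative `(∇_X φ)Y` -/
def nablaPhi (C : SmoothCtx) (A : AlmostContactMetric C)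
    (D : LeviCivita C A.toMetricStr) (X Y : C.Vec) : C.Vec :=
  D.nabla X (A.φ Y) - A.φ (D.nabla X Y)

/-- a Killing vector field: `L_ξ g = 0` -/
def IsKilling (C : SmoothCtx) (G : MetricStr C) (ξ : C.Vec) : Prop :=
  ∀ X Y, C.act ξ (G.g X Y) - G.g (C.bracket ξ X) Y - G.g X (C.bracket ξ Y) = 0

/-- the exterior differential as a linear map -/
def dLin (C : SmoothCtx) (k : ℕ) : C.Form k →ₗ[ℝ] C.Form (k + 1) where
  toFun := C.d
  map_add' := C.d_add
  map_smul' := fun r α => C.d_smulR r α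

/-- the Betti numbers: dimensions of the de Rham cohomology spaces -/
def betti (C : SmoothCtx) : ℕ → ℕ
  | 0 => Module.finrank ℝ (LinearMap.ker (dLin C 0))
  | k + 1 => Module.finrank ℝ
      (↥(LinearMap.ker (dLin C (k + 1))) ⧸
        (LinearMap.range (dLin C k)).comap (LinearMap.ker (dLin C (k + 1))).subtype)

end
noncomputable section

/-- the codifferential `δα = -Σᵢ (∇_{Eᵢ} α)(Eᵢ)` of a 1-form -/
def codiff1 (C : SmoothCtx) (G : MetricStr C) (D : LeviCivita C G)
    (F : OrthFrame C G) (α : C.Form 1) : C.Fn :=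
  - ∑ i, (C.act (F.E i) (C.ap1 α (F.E i)) - C.ap1 α (D.nabla (F.E i) (F.E i)))

/-- the codifferential `(δβ)(X) = -Σᵢ (∇_{Eᵢ} β)(Eᵢ, X)` of a 2-form -/
def codiff2 (C : SmoothCtx) (G : MetricStr C) (D : LeviCivita C G)
    (F : OrthFrame C G) (β : C.Form 2) (X : C.Vec) : C.Fn :=
  - ∑ i, (C.act (F.E i) (C.ap2 β (F.E i) X)
      - C.ap2 β (D.nabla (F.E i) (F.E i)) X
      - C.ap2 β (F.E i) (D.nabla (F.E i) X))

/-- the codifferential `(δγ)(X,Y) = -Σᵢ (∇_{Eᵢ} γ)(Eᵢ, X, Y)` of a 3-form -/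
def codiff3 (C : SmoothCtx) (G : MetricStr C) (D : LeviCivita C G)
    (F : OrthFrame C G) (γ : C.Form 3) (X Y : C.Vec) : C.Fn :=
  - ∑ i, (C.act (F.E i) (C.evK γ ![F.E i, X, Y])
      - C.evK γ ![D.nabla (F.E i) (F.E i), X, Y]
      - C.evK γ ![F.E i, D.nabla (F.E i) X, Y]
      - C.evK γ ![F.E i, X, D.nabla (F.E i) Y])

/-- a 1-form is harmonic when it is annihilated by the Hodge Laplacian
`Δ = dδ + δd` -/
def Harmonic1 (C : SmoothCtx) (G : MetricStr C) (D : LeviCivita C G)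
    (F : OrthFrame C G) (α : C.Form 1) : Prop :=
  ∀ X, C.act X (codiff1 C G D F α) + codiff2 C G D F (C.d α) X = 0

/-- a 2-form is harmonic when it is annihilated by the Hodge Laplacian
`Δ = dδ + δd`; the exterior differential of the 1-form `δβ` is computed via
the Koszul formula -/
def Harmonic2 (C : SmoothCtx) (G : MetricStr C) (D : LeviCivita C G)
    (F : OrthFrame C G) (β : C.Form 2) : Prop :=
  ∀ X Y, (C.act X (codiff2 C G D F β Y) - C.act Y (codiff2 C G D F β X)
      - codiff2 C G D F β (C.bracket X Y)) + codiff3 C G D F (C.d β) X Y = 0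

namespace SmoothCtx

variable (C : SmoothCtx)

lemma eq_zero_of_add_self {a : C.Fn} (h : a + a = 0) : a = 0 := by
  have h2 : (2 : ℝ) • a = 0 := by rw [two_smul, h]
  simpa [smul_smul] using congrArg (fun b => (2⁻¹ : ℝ) • b) h2

lemma act_zero (X : C.Vec) : C.act X 0 = 0 := by
  simpa using C.act_add X 0 0

lemma act_one (X : C.Vec) : C.act X 1 = 0 := by
  simpa using C.act_mul X 1 1

lemma evK_zero {k : ℕ} (v : Fin k → C.Vec) : C.evK (0 : C.Form k) v = 0 := by
  simpa using C.evK_add (0 : C.Form k) 0 v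

end SmoothCtx

namespace MetricStr

variable {C : SmoothCtx} (G : MetricStr C)

lemma g_add_right (X Y Z : C.Vec) : G.g X (Y + Z) = G.g X Y + G.g X Z := by
  rw [G.g_symm, G.g_add, G.g_symm Y, G.g_symm Z]

lemma g_smul_right (f : C.Fn) (X Y : C.Vec) : G.g X (f • Y) = f * G.g X Y := by
  rw [G.g_symm, G.g_smul, G.g_symm Y]

/-- the metric as a bilinear map -/
def bilin : C.Vec →ₗ[C.Fn] C.Vec →ₗ[C.Fn] C.Fn :=
  LinearMap.mk₂ C.Fn G.g G.g_add G.g_smul G.g_add_right G.g_smul_right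

lemma g_neg_right (X Y : C.Vec) : G.g X (-Y) = -G.g X Y :=
  map_neg (G.bilin X) Y

lemma g_zero_right (X : C.Vec) : G.g X 0 = 0 :=
  map_zero (G.bilin X)

lemma g_sub_left (X Y Z : C.Vec) : G.g (X - Y) Z = G.g X Z - G.g Y Z :=
  LinearMap.map_sub₂ G.bilin X Y Z

lemma g_sub_right (X Y Z : C.Vec) : G.g X (Y - Z) = G.g X Y - G.g X Z :=
  map_sub (G.bilin X) Y Z

end MetricStr

namespace OrthFrame

variable {C : SmoothCtx} {G : MetricStr C} (F : OrthFrame C G)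

lemma parseval (X Y : C.Vec) : ∑ i, G.g (F.E i) X * G.g (F.E i) Y = G.g X Y := by
  have h := congrArg (fun Z => G.bilin Z Y) (F.span X)
  simp only [map_sum, map_smul, LinearMap.sum_apply, LinearMap.smul_apply, smul_eq_mul] at h
  refine Eq.trans (Finset.sum_congr rfl fun i _ => ?_) h
  rw [G.g_symm (F.E i) X]
  rfl

lemma eq_zero_of_forall_g (F : OrthFrame C G) {X : C.Vec} (h : ∀ Y, G.g X Y = 0) : X = 0 := by
  rw [← F.span X]
  simp [h]

/-- contraction of a bilinear form with a skew-symmetric endomorphism -/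
lemma sum_skew (S : C.Vec → C.Vec) (hS : ∀ X Y, G.g (S X) Y = -G.g X (S Y))
    (T : C.Vec →ₗ[C.Fn] C.Vec →ₗ[C.Fn] C.Fn) :
    ∑ i, T (S (F.E i)) (F.E i) = -∑ i, T (F.E i) (S (F.E i)) := by
  have hl : ∀ i, T (S (F.E i)) (F.E i)
      = ∑ j, G.g (S (F.E i)) (F.E j) * T (F.E j) (F.E i) := fun i => by
    conv_lhs => rw [← F.span (S (F.E i))]
    simp
  have hr : ∀ j, T (F.E j) (S (F.E j))
      = ∑ i, G.g (S (F.E j)) (F.E i) * T (F.E j) (F.E i) := fun j => by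
    conv_lhs => rw [← F.span (S (F.E j))]
    simp
  simp only [hl, hr]
  rw [Finset.sum_comm, ← Finset.sum_neg_distrib]
  refine Finset.sum_congr rfl fun j _ => ?_
  rw [← Finset.sum_neg_distrib]
  refine Finset.sum_congr rfl fun i _ => ?_
  rw [hS, G.g_symm (F.E i)]
  ring

end OrthFrame

namespace AlmostContactMetric

variable {C : SmoothCtx} (A : AlmostContactMetric C)

lemma φ_neg (X : C.Vec) : A.φ (-X) = -A.φ X := by
  simpa using A.φ_smul (-1) X

lemma φ_sub (X Y : C.Vec) : A.φ (X - Y) = A.φ X - A.φ Y := by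
  rw [sub_eq_add_neg, A.φ_add, A.φ_neg, sub_eq_add_neg]

lemma g_φ_self (X : C.Vec) : A.g X (A.φ X) = 0 := by
  rw [← A.Φ_eval]
  exact C.evK_alt A.Φ ![X, X] 0 1 (by decide) rfl

lemma g_φ_left (X Y : C.Vec) : A.g (A.φ X) Y = -A.g X (A.φ Y) := by
  have h := A.g_φ_self (X + Y)
  rw [A.φ_add, A.g_add, A.g_add_right, A.g_add_right, A.g_φ_self, A.g_φ_self,
    A.g_symm Y] at h
  linear_combination h

lemma φ_φ_ξ : A.φ (A.φ A.ξ) = 0 := by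
  rw [A.acs_sq, A.acs_eta, one_smul, neg_add_cancel]

lemma η_eq (X : C.Vec) : C.ap1 A.η X = A.g X A.ξ := by
  have h := A.compat_g X A.ξ
  rw [A.g_φ_left, A.φ_φ_ξ, A.g_zero_right, A.acs_eta] at h
  linear_combination h

lemma g_ξ_ξ : A.g A.ξ A.ξ = 1 := by
  rw [← A.η_eq, A.acs_eta]

lemma φ_φ (X : C.Vec) : A.φ (A.φ X) = -X + A.g X A.ξ • A.ξ := by
  rw [A.acs_sq, A.η_eq]

lemma φ_ξ (F : OrthFrame C A.toMetricStr) : A.φ A.ξ = 0 := by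
  refine F.eq_zero_of_forall_g fun Y => ?_
  have h := A.g_φ_left (A.φ A.ξ) (A.φ Y)
  rw [A.φ_φ_ξ, A.φ_φ, A.g_add_right, A.g_neg_right, A.g_smul_right,
    A.g_symm (A.φ A.ξ) A.ξ, A.g_φ_self, A.g_symm 0, A.g_zero_right] at h
  linear_combination -h

variable (D : LeviCivita C A.toMetricStr)

lemma g_ξ_nabla_ξ (X : C.Vec) : A.g A.ξ (D.nabla X A.ξ) = 0 := by
  refine C.eq_zero_of_add_self ?_
  have h := D.compat X A.ξ A.ξ
  rw [A.g_ξ_ξ, C.act_one, A.g_symm _ A.ξ] at h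
  exact h.symm

end AlmostContactMetric

namespace LeviCivita

variable {C : SmoothCtx} {G : MetricStr C} (D : LeviCivita C G)

lemma nabla_neg_right (X Y : C.Vec) : D.nabla X (-Y) = -D.nabla X Y :=
  map_neg (AddMonoidHom.mk' (D.nabla X) (D.nabla_addr X)) Y

end LeviCivita

section NablaPhi

variable {C : SmoothCtx} (A : AlmostContactMetric C) (D : LeviCivita C A.toMetricStr)

/-- the covariant derivative of `φ` as a bilinear map -/
def nablaPhiLin : C.Vec →ₗ[C.Fn] C.Vec →ₗ[C.Fn] C.Vec :=
  LinearMap.mk₂ C.Fn (nablaPhi C A D)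
    (fun X Y Z => by simp only [nablaPhi, D.nabla_addl, A.φ_add]; abel)
    (fun f X Y => by simp only [nablaPhi, D.nabla_smull, A.φ_smul, smul_sub])
    (fun X Y Z => by simp only [nablaPhi, D.nabla_addr, A.φ_add]; abel)
    (fun f X Y => by
      simp only [nablaPhi, D.nabla_leibniz, A.φ_smul, A.φ_add, smul_sub]; abel)

/-- `(∇_X Φ)(Y, Z) = g(Y, (∇_X φ) Z)` -/
lemma act_g_φ (X Y Z : C.Vec) :
    C.act X (A.g Y (A.φ Z)) = A.g (D.nabla X Y) (A.φ Z) + A.g Y (A.φ (D.nabla X Z))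
      + A.g Y (nablaPhi C A D X Z) := by
  rw [D.compat, nablaPhi, A.g_sub_right]
  ring

lemma g_nablaPhi_skew (X Y Z : C.Vec) :
    A.g Y (nablaPhi C A D X Z) = -A.g Z (nablaPhi C A D X Y) := by
  have h1 := act_g_φ A D X Y Z
  have h2 := act_g_φ A D X Z Y
  have h3 := C.act_add X (A.g Y (A.φ Z)) (A.g Z (A.φ Y))
  have hs : ∀ U V, A.g U (A.φ V) = -A.g V (A.φ U) := fun U V => by
    rw [A.g_symm, A.g_φ_left]
  rw [hs Y Z, neg_add_cancel, C.act_zero, ← hs Y Z] at h3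
  linear_combination -h1 - h2 - h3 - hs (D.nabla X Y) Z - hs Y (D.nabla X Z)

lemma nablaPhi_φ (X Z : C.Vec) :
    nablaPhi C A D X (A.φ Z) + A.φ (nablaPhi C A D X Z)
      = A.g Z A.ξ • D.nabla X A.ξ + A.g Z (D.nabla X A.ξ) • A.ξ := by
  simp only [nablaPhi, A.φ_sub, A.φ_φ, D.nabla_addr, D.nabla_neg_right, D.nabla_leibniz,
    D.compat, add_smul]
  abel

variable (F : OrthFrame C A.toMetricStr)

/-- the trace of `(∇_X φ) ∘ φ` vanishes -/
lemma sum_g_nablaPhi_φ (X : C.Vec) :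
    ∑ i, A.g (F.E i) (nablaPhi C A D X (A.φ (F.E i))) = 0 := by
  refine C.eq_zero_of_add_self ?_
  have h : ∀ i, A.g (F.E i) (nablaPhi C A D X (A.φ (F.E i)))
      + A.g (F.E i) (nablaPhi C A D X (A.φ (F.E i)))
      = A.g (F.E i) A.ξ * A.g (F.E i) (D.nabla X A.ξ)
        + A.g (F.E i) A.ξ * A.g (F.E i) (D.nabla X A.ξ) := fun i => by
    have h1 := congrArg (A.g (F.E i)) (nablaPhi_φ A D X (F.E i))
    have h2 := A.g_φ_left (F.E i) (nablaPhi C A D X (F.E i))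
    have h3 := g_nablaPhi_skew A D X (A.φ (F.E i)) (F.E i)
    rw [A.g_add_right, A.g_add_right, A.g_smul_right, A.g_smul_right] at h1
    linear_combination h1 - h2 + h3
  rw [← Finset.sum_add_distrib, Finset.sum_congr rfl fun i _ => h i,
    Finset.sum_add_distrib, F.parseval, A.g_ξ_nabla_ξ, add_zero]

lemma codiff1_η : codiff1 C A.toMetricStr D F A.η
    = -∑ i, A.g (F.E i) (D.nabla (F.E i) A.ξ) := by
  simp only [codiff1, A.η_eq, D.compat, add_sub_cancel_left]

lemma codiff2_Φ (X : C.Vec) : codiff2 C A.toMetricStr D F A.Φ X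
    = -∑ i, A.g (F.E i) (nablaPhi C A D (F.E i) X) := by
  simp only [codiff2, A.Φ_eval, act_g_φ A D]
  congr 1
  refine Finset.sum_congr rfl fun i _ => ?_
  ring

end NablaPhi

namespace IsAlmostCoKaehler

variable {C : SmoothCtx} {A : AlmostContactMetric C}
  (D : LeviCivita C A.toMetricStr) (F : OrthFrame C A.toMetricStr)

lemma g_nabla_ξ_symm (hA : IsAlmostCoKaehler C A) (X Y : C.Vec) :
    A.g X (D.nabla Y A.ξ) = A.g Y (D.nabla X A.ξ) := by
  have h := C.d1_eval A.η X Y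
  simp only [← SmoothCtx.ap1.eq_1] at h
  rw [hA.1, C.evK_zero, A.η_eq, A.η_eq, A.η_eq, ← D.torsion_free, D.compat, D.compat,
    A.g_sub_left] at h
  linear_combination h

lemma g_nablaPhi_cyclic (hA : IsAlmostCoKaehler C A) (X Y Z : C.Vec) :
    A.g Y (nablaPhi C A D X Z) - A.g X (nablaPhi C A D Y Z)
      + A.g X (nablaPhi C A D Z Y) = 0 := by
  have h := C.d2_eval A.Φ X Y Z
  simp only [← SmoothCtx.ap2.eq_1] at h
  simp only [hA.2, C.evK_zero, A.Φ_eval, ← D.torsion_free, act_g_φ A D, A.g_sub_left] at h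
  have hs : ∀ U V, A.g U (A.φ V) = -A.g V (A.φ U) := fun U V => by
    rw [A.g_symm, A.g_φ_left]
  linear_combination -h - hs Y (D.nabla X Z) + hs X (D.nabla Y Z) - hs X (D.nabla Z Y)

lemma sum_g_nablaPhi_frame_φ (hA : IsAlmostCoKaehler C A) (X : C.Vec) :
    ∑ i, A.g X (nablaPhi C A D (F.E i) (A.φ (F.E i))) = 0 := by
  refine C.eq_zero_of_add_self ?_
  have h := Finset.sum_congr rfl fun i (_ : i ∈ Finset.univ) =>
    hA.g_nablaPhi_cyclic D X (F.E i) (A.φ (F.E i))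
  have hskew : ∑ i, A.g X (nablaPhi C A D (A.φ (F.E i)) (F.E i))
      = -∑ i, A.g X (nablaPhi C A D (F.E i) (A.φ (F.E i))) :=
    F.sum_skew A.φ A.g_φ_left ((nablaPhiLin A D).compr₂ (A.bilin X))
  rw [Finset.sum_add_distrib, Finset.sum_sub_distrib, sum_g_nablaPhi_φ, hskew,
    Finset.sum_const_zero] at h
  linear_combination -h

lemma sum_g_nablaPhi_φ_eq (hA : IsAlmostCoKaehler C A) (X : C.Vec) :
    ∑ i, A.g (F.E i) (nablaPhi C A D (F.E i) (A.φ X))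
      = A.g X A.ξ * ∑ i, A.g (F.E i) (D.nabla (F.E i) A.ξ) := by
  have h : ∀ i, A.g (F.E i) (nablaPhi C A D (F.E i) (A.φ X))
      = A.g X A.ξ * A.g (F.E i) (D.nabla (F.E i) A.ξ)
        + A.g (F.E i) A.ξ * A.g (F.E i) (D.nabla X A.ξ)
        - A.g X (nablaPhi C A D (F.E i) (A.φ (F.E i))) := fun i => by
    have h1 := congrArg (A.g (F.E i)) (nablaPhi_φ A D (F.E i) X)
    have h2 := A.g_φ_left (F.E i) (nablaPhi C A D (F.E i) X)
    have h3 := g_nablaPhi_skew A D (F.E i) (A.φ (F.E i)) X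
    rw [A.g_add_right, A.g_add_right, A.g_smul_right, A.g_smul_right,
      hA.g_nabla_ξ_symm D X] at h1
    linear_combination h1 - h2 + h3
  rw [Finset.sum_congr rfl fun i _ => h i, Finset.sum_sub_distrib, Finset.sum_add_distrib,
    F.parseval, A.g_ξ_nabla_ξ, hA.sum_g_nablaPhi_frame_φ, Finset.mul_sum, add_zero, sub_zero]

/-- the Reeb vector field is divergence free -/
lemma sum_g_nabla_ξ (hA : IsAlmostCoKaehler C A) :
    ∑ i, A.g (F.E i) (D.nabla (F.E i) A.ξ) = 0 := by
  have h := hA.sum_g_nablaPhi_φ_eq D F A.ξ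
  rw [A.g_ξ_ξ, one_mul, A.φ_ξ F] at h
  rw [← h]
  refine Finset.sum_eq_zero fun i _ => ?_
  exact (congrArg _ (map_zero (nablaPhiLin A D (F.E i)))).trans (A.g_zero_right _)

lemma sum_g_nablaPhi_ξ (hA : IsAlmostCoKaehler C A) :
    ∑ i, A.g (F.E i) (nablaPhi C A D (F.E i) A.ξ) = 0 := by
  refine C.eq_zero_of_add_self ?_
  let T : C.Vec →ₗ[C.Fn] C.Vec →ₗ[C.Fn] C.Fn := LinearMap.mk₂ C.Fn
    (fun X Y => A.g X (D.nabla Y A.ξ)) (fun X Y Z => A.g_add X Y _)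
    (fun f X Y => A.g_smul f X _)
    (fun X Y Z => by rw [D.nabla_addl, A.g_add_right])
    (fun f X Y => by rw [D.nabla_smull, A.g_smul_right, smul_eq_mul])
  have hT : ∑ i, A.g (A.φ (F.E i)) (D.nabla (F.E i) A.ξ)
      = -∑ i, A.g (F.E i) (D.nabla (A.φ (F.E i)) A.ξ) := F.sum_skew A.φ A.g_φ_left T
  have h : ∀ i, A.g (F.E i) (nablaPhi C A D (F.E i) A.ξ)
      = A.g (A.φ (F.E i)) (D.nabla (F.E i) A.ξ) := fun i => by
    have hz : D.nabla (F.E i) 0 = 0 := by simpa using D.nabla_addr (F.E i) 0 0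
    rw [nablaPhi, A.φ_ξ F, hz, zero_sub, A.g_neg_right, A.g_φ_left]
  simp only [h]
  nth_rewrite 2 [hT]
  simp only [fun i => hA.g_nabla_ξ_symm D (F.E i) (A.φ (F.E i)), add_neg_cancel]

lemma codiff1_η_eq_zero (hA : IsAlmostCoKaehler C A) : codiff1 C A.toMetricStr D F A.η = 0 := by
  rw [codiff1_η, hA.sum_g_nabla_ξ, neg_zero]

lemma codiff2_Φ_eq_zero (hA : IsAlmostCoKaehler C A) (X : C.Vec) :
    codiff2 C A.toMetricStr D F A.Φ X = 0 := by
  have hX : X = -A.φ (A.φ X) + A.g X A.ξ • A.ξ := by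
    rw [A.φ_φ, neg_add, neg_neg, add_assoc, neg_add_cancel, add_zero]
  have h : ∀ i, A.g (F.E i) (nablaPhi C A D (F.E i) X)
      = -A.g (F.E i) (nablaPhi C A D (F.E i) (A.φ (A.φ X)))
        + A.g X A.ξ * A.g (F.E i) (nablaPhi C A D (F.E i) A.ξ) := fun i => by
    have hl := map_add ((A.bilin (F.E i)).comp (nablaPhiLin A D (F.E i)))
      (-A.φ (A.φ X)) (A.g X A.ξ • A.ξ)
    rw [← hX, map_neg, map_smul] at hl
    exact hl
  rw [codiff2_Φ, Finset.sum_congr rfl fun i _ => h i, Finset.sum_add_distrib,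
    Finset.sum_neg_distrib, ← Finset.mul_sum, hA.sum_g_nablaPhi_φ_eq, hA.sum_g_nabla_ξ,
    hA.sum_g_nablaPhi_ξ]
  simp

end IsAlmostCoKaehler

/-- on any almost coKähler manifold the 1-form `η` and the
fundamental 2-form `Φ` are harmonic. -/
theorem statement_6 (C : SmoothCtx) (A : AlmostContactMetric C)
    (D : LeviCivita C A.toMetricStr) (F : OrthFrame C A.toMetricStr)
    (hack : IsAlmostCoKaehler C A) :
    Harmonic1 C A.toMetricStr D F A.η ∧ Harmonic2 C A.toMetricStr D F A.Φ := by
  refine ⟨fun X => ?_, fun X Y => ?_⟩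
  · rw [hack.codiff1_η_eq_zero, C.act_zero, hack.1]
    simp [codiff2, SmoothCtx.ap2, C.evK_zero, C.act_zero]
  · simp only [hack.codiff2_Φ_eq_zero, C.act_zero, hack.2]
    simp [codiff3, C.evK_zero, C.act_zero]

end
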